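/- For every integer k ≥ 4 there exists α_0 > 0 such that for every 0 < α ≤ α_0 there exists ε_0 > 0 such that for every 0 < ε ≤ ε_0 there exists n_0 such that for all n ≥ n_0 the following holds: every 2-edge-coloured (1−ε, α)-dense k-graph H on n vertices has a 3√ε-blueprint G with V(G) = V(H) such that G, viewed as a (k−2)-graph on n vertices, is (1 − α^{1/(4(k−2)²+1)}, α^{1/(4(k−2)²+1)})-dense. -/

import Mathlib

open Finset

/-- `degOn k H S W` is `d_H(S, W)`: the number of `(k - |S|)`-element subsets `e` of `W`
with `e ∪ S` an edge of the `k`-graph `H`. -/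
def degOn {V : Type*} [DecidableEq V] (k : ℕ) (H : Finset (Finset V)) (S W : Finset V) : ℕ :=
  ((W.powersetCard (k - S.card)).filter (fun e => e ∪ S ∈ H)).card

/-- `degT k H S` is `d_H(S) = d_H(S, V)`. -/
def degT {V : Type*} [Fintype V] [DecidableEq V] (k : ℕ) (H : Finset (Finset V))
    (S : Finset V) : ℕ :=
  degOn k H S Finset.univ

/-- A `k`-graph `H` on the vertex set `V` is `(μ, α)`-dense. -/
def IsDense {V : Type*} [Fintype V] [DecidableEq V] (k : ℕ) (H : Finset (Finset V))
    (μ α : ℝ) : Prop :=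
  ∀ i : ℕ, 1 ≤ i → i ≤ k - 1 →
    (({S : Finset V | S.card = i ∧
        (degT k H S : ℝ) < μ * ((Fintype.card V).choose (k - i))}.ncard : ℝ)
      ≤ α * ((Fintype.card V).choose i)) ∧
    ∀ S : Finset V, S.card = i →
      (degT k H S : ℝ) < μ * ((Fintype.card V).choose (k - i)) → degT k H S = 0

/-- Two edges `f, f'` of a `k`-graph `Hc` are tightly connected: there is a walk of edges,
consecutive ones sharing `k - 1` vertices. -/
def TightConn {V : Type*} [DecidableEq V] (k : ℕ) (Hc : Finset (Finset V)) (f f' : Finset V) : Prop :=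
  ∃ (t : ℕ) (e : ℕ → Finset V), e 0 = f ∧ e t = f' ∧ (∀ i ≤ t, e i ∈ Hc) ∧
    ∀ i < t, ((e i) ∩ (e (i + 1))).card = k - 1

/-- `C` is a tightly connected subgraph of the `k`-graph `Hc`. -/
def IsTCSub {V : Type*} [DecidableEq V] (k : ℕ) (Hc C : Finset (Finset V)) : Prop :=
  C ⊆ Hc ∧ ∀ f ∈ C, ∀ f' ∈ C, TightConn k Hc f f'

/-- `C` is a tight component (a maximal tightly connected subgraph) of the `k`-graph `Hc`. -/
def IsTightComponent {V : Type*} [DecidableEq V] (k : ℕ) (Hc C : Finset (Finset V)) : Prop :=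
  IsTCSub k Hc C ∧ ∀ C' : Finset (Finset V), IsTCSub k Hc C' → C ⊆ C' → C' = C

/-- The shadow of `H` consisting of all `r`-element sets contained in some edge of `H`. -/
def shadowTo {V : Type*} [Fintype V] [DecidableEq V] (r : ℕ) (H : Finset (Finset V)) :
    Finset (Finset V) :=
  ((Finset.univ : Finset V).powersetCard r).filter (fun e => ∃ f ∈ H, e ⊆ f)

/-- An `ε`-blueprint for a 2-edge-coloured `k`-graph `H` (with colouring `cH`, `true` = red):
a 2-edge-coloured `(k-2)`-graph together with the assignment `comp` of monochromatic tight
components, satisfying (BP1) and (BP2). -/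
structure Blueprint (k : ℕ) {V : Type*} [Fintype V] [DecidableEq V]
    (H : Finset (Finset V)) (cH : Finset V → Bool) (ε : ℝ) where
  verts : Finset V
  edges : Finset (Finset V)
  col : Finset V → Bool
  comp : Finset V → Finset (Finset V)
  edges_card : ∀ e ∈ edges, e.card = k - 2
  edges_sub : ∀ e ∈ edges, e ⊆ verts
  comp_is : ∀ e ∈ edges, IsTightComponent k (H.filter (fun f => cH f = col e)) (comp e)
  comp_deg : ∀ e ∈ edges,
    (1 - ε) * (Fintype.card V : ℝ) ≤ (degT (k - 1) (shadowTo (k - 1) (comp e)) e : ℝ)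
  comp_agree : ∀ e ∈ edges, ∀ e' ∈ edges, col e = col e' → (e ∩ e').card = k - 3 →
    comp e = comp e'

/-- For a subset `G'` of the edges of a blueprint `G`, the `k`-graph `(G')⁺`: all edges of
`⋃_{e ∈ G'} H(e)` containing some edge of `G'`. -/
def Blueprint.plus {k : ℕ} {V : Type*} [Fintype V] [DecidableEq V]
    {H : Finset (Finset V)} {cH : Finset V → Bool} {ε : ℝ}
    (G : Blueprint k H cH ε) (G' : Finset (Finset V)) : Finset (Finset V) :=
  (G'.biUnion (fun e => G.comp e)).filter (fun f => ∃ e ∈ G', e ⊆ f)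

/-- `M` is a matching: a set of pairwise disjoint edges. -/
def IsMatching {V : Type*} [DecidableEq V] (M : Finset (Finset V)) : Prop :=
  ∀ e ∈ M, ∀ f ∈ M, e ≠ f → Disjoint e f

/-- `M` is a tightly connected matching in the `k`-graph `Hc`. -/
def IsTCMatching {V : Type*} [DecidableEq V] (k : ℕ) (Hc M : Finset (Finset V)) : Prop :=
  M ⊆ Hc ∧ IsMatching M ∧ ∀ e ∈ M, ∀ f ∈ M, TightConn k Hc e f

section helpers

variable {V : Type*} [DecidableEq V]

lemma tc_refl (k : ℕ) (Hc : Finset (Finset V)) {f : Finset V} (hf : f ∈ Hc) :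
    TightConn k Hc f f :=
  ⟨0, fun _ => f, rfl, rfl, fun _ _ => hf, fun i hi => absurd hi (by omega)⟩

lemma tc_symm {k : ℕ} {Hc : Finset (Finset V)} {f g : Finset V} (h : TightConn k Hc f g) :
    TightConn k Hc g f := by
  obtain ⟨t, e, h0, ht, hm, hs⟩ := h
  refine ⟨t, fun i => e (t - i), by simpa using ht, by simpa using h0,
    fun i _ => hm _ (by omega), fun i hi => ?_⟩
  have := hs (t - (i + 1)) (by omega)
  rw [show t - (i + 1) + 1 = t - i by omega] at this
  rw [Finset.inter_comm]; exact this

lemma tc_trans {k : ℕ} {Hc : Finset (Finset V)} {f g l : Finset V} (h : TightConn k Hc f g)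
    (h' : TightConn k Hc g l) : TightConn k Hc f l := by
  obtain ⟨t, e, h0, ht, hm, hs⟩ := h
  obtain ⟨t', e', h0', ht', hm', hs'⟩ := h'
  refine ⟨t + t', fun i => if i ≤ t then e i else e' (i - t), by simpa using h0, ?_, ?_, ?_⟩
  · by_cases h : t' = 0
    · subst h; simp [ht, ← ht', h0']
    · have : ¬ (t + t' ≤ t) := by omega
      simp [h, ht']
  · intro i hi
    by_cases h : i ≤ t
    · simp only [h, if_true]; exact hm i h
    · simp only [h, if_false]; exact hm' _ (by omega)
  · intro i hi
    rcases lt_trichotomy i t with h | h | h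
    · simp only [show i ≤ t by omega, show i + 1 ≤ t by omega, if_true]; exact hs i h
    · subst h
      have := hs' 0 (by omega)
      simp only [le_refl, if_true, show ¬ (i + 1 ≤ i) by omega, if_false]
      rw [show i + 1 - i = 0 + 1 by omega, ht, ← h0']; exact this
    · simp only [show ¬ i ≤ t by omega, show ¬ (i + 1 ≤ t) by omega, if_false]
      rw [show i + 1 - t = i - t + 1 by omega]; exact hs' _ (by omega)

lemma tc_mem_right {k : ℕ} {Hc : Finset (Finset V)} {f g : Finset V} (h : TightConn k Hc f g) :
    g ∈ Hc := by
  obtain ⟨t, e, h0, ht, hm, hs⟩ := h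
  exact ht ▸ hm t le_rfl

lemma tc_of_common {k : ℕ} {Hc : Finset (Finset V)} (hu : ∀ e ∈ Hc, e.card = k)
    {f e e' : Finset V} (hf : f.card = k - 1) (hk : 1 ≤ k) (he : e ∈ Hc) (he' : e' ∈ Hc)
    (hfe : f ⊆ e) (hfe' : f ⊆ e') : TightConn k Hc e e' := by
  by_cases h : e = e'
  · subst h; exact tc_refl k Hc he
  refine ⟨1, fun i => if i = 0 then e else e', rfl, rfl, ?_, ?_⟩
  · intro i _; by_cases h : i = 0 <;> simp [h, he, he']
  · intro i hi
    have : i = 0 := by omega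
    subst this
    simp only [if_true, zero_add, one_ne_zero, if_false]
    have h1 : k - 1 ≤ (e ∩ e').card := hf ▸ card_le_card (subset_inter hfe hfe')
    have h2 : (e ∩ e').card < k := by
      by_contra hc
      push Not at hc
      have ha : e ∩ e' = e := eq_of_subset_of_card_le inter_subset_left (by rw [hu e he]; exact hc)
      have hb : e ∩ e' = e' := eq_of_subset_of_card_le inter_subset_right (by rw [hu e' he']; exact hc)
      exact h (ha.symm.trans hb)
    omega

open Classical in
/-- The tight component of `Hc` of the edges containing `f`. -/
noncomputable def KK (k : ℕ) (Hc : Finset (Finset V)) (f : Finset V) : Finset (Finset V) :=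
  Hc.filter (fun e => ∃ e' ∈ Hc, f ⊆ e' ∧ TightConn k Hc e' e)

lemma KK_def (k : ℕ) (Hc : Finset (Finset V)) (f e : Finset V) :
    e ∈ KK k Hc f ↔ e ∈ Hc ∧ ∃ e' ∈ Hc, f ⊆ e' ∧ TightConn k Hc e' e := by
  classical
  unfold KK
  exact Finset.mem_filter

lemma mem_KK {k : ℕ} {Hc : Finset (Finset V)} (hu : ∀ e ∈ Hc, e.card = k) (hk : 1 ≤ k)
    {f e0 : Finset V} (hf : f.card = k - 1) (he0 : e0 ∈ Hc) (hfe : f ⊆ e0) (e : Finset V) :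
    e ∈ KK k Hc f ↔ TightConn k Hc e0 e := by
  rw [KK_def]
  constructor
  · rintro ⟨_, e', he', hfe', ht⟩
    exact tc_trans (tc_of_common hu hf hk he0 he' hfe hfe') ht
  · intro h
    exact ⟨tc_mem_right h, e0, he0, hfe, h⟩

lemma KK_eq {k : ℕ} {Hc : Finset (Finset V)} (hu : ∀ e ∈ Hc, e.card = k) (hk : 1 ≤ k)
    {f f' e0 : Finset V} (hf : f.card = k - 1) (hf' : f'.card = k - 1) (he0 : e0 ∈ Hc)
    (hfe : f ⊆ e0) (hfe' : f' ⊆ e0) : KK k Hc f = KK k Hc f' := by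
  ext e
  rw [mem_KK hu hk hf he0 hfe, mem_KK hu hk hf' he0 hfe']

lemma KK_comp {k : ℕ} {Hc : Finset (Finset V)} (hu : ∀ e ∈ Hc, e.card = k) (hk : 1 ≤ k)
    {f e0 : Finset V} (hf : f.card = k - 1) (he0 : e0 ∈ Hc) (hfe : f ⊆ e0) :
    IsTightComponent k Hc (KK k Hc f) := by
  have hm := mem_KK hu hk hf he0 hfe
  refine ⟨⟨fun e he => tc_mem_right ((hm e).1 he), fun a ha b hb =>
    tc_trans (tc_symm ((hm a).1 ha)) ((hm b).1 hb)⟩, ?_⟩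
  intro C' hC' hsub
  refine Finset.Subset.antisymm ?_ hsub
  intro e he
  rw [hm]
  exact hC'.2 e0 (hsub ((hm e0).2 (tc_refl k Hc he0))) e he

lemma KK_shadow [Fintype V] {k : ℕ} {Hc : Finset (Finset V)} {f : Finset V}
    (hf : f.card = k - 1) (hne : (KK k Hc f).Nonempty) : f ∈ shadowTo (k - 1) (KK k Hc f) := by
  obtain ⟨e, he⟩ := hne
  have he2 := he
  rw [KK_def] at he2
  obtain ⟨_, e', he', hfe', ht⟩ := he2
  unfold shadowTo
  rw [Finset.mem_filter, Finset.mem_powersetCard]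
  refine ⟨⟨subset_univ _, hf⟩, e', ?_, hfe'⟩
  rw [KK_def]
  exact ⟨he', e', he', hfe', tc_refl k Hc he'⟩

lemma link_lemma {κ : Type*} (W : Finset V) (d : ℕ) (E : Bool → V → V → Prop)
    (K : Bool → V → κ) (hW : 3 * d < W.card)
    (hsym : ∀ c x y, E c x y → E c y x)
    (hK : ∀ c x y, E c x y → K c x = K c y)
    (hd : ∀ w ∈ W, ∀ U : Finset V, (∀ u ∈ U, ¬ E true w u ∧ ¬ E false w u) → U.card ≤ d) :
    ∃ c w u, w ∈ W ∧ E c w u ∧ ∃ A ⊆ W, W.card ≤ A.card + 2 * d ∧ ∀ a ∈ A, K c a = K c w := by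
  classical
  have hd' : ∀ c, ∀ w ∈ W, ∀ U : Finset V, (∀ u ∈ U, ¬ E c w u ∧ ¬ E (!c) w u) → U.card ≤ d := by
    intro c w hw U hU
    apply hd w hw U
    intro u hu
    cases c
    · exact ⟨(hU u hu).2, (hU u hu).1⟩
    · exact hU u hu
  obtain ⟨w, hw⟩ : W.Nonempty := card_pos.1 (by omega)
  have hc : ∃ c, d < (W.filter (fun u => E c w u)).card := by
    by_contra hcon
    push Not at hcon
    have h1 := hcon true
    have h2 := hcon false
    have h3 := hd w hw (W.filter (fun u => ¬ E true w u ∧ ¬ E false w u))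
      (fun u hu => (Finset.mem_filter.1 hu).2)
    have h4 : W ⊆ W.filter (fun u => E true w u) ∪ W.filter (fun u => E false w u) ∪
        W.filter (fun u => ¬ E true w u ∧ ¬ E false w u) := by
      intro u hu
      simp only [Finset.mem_union, Finset.mem_filter, hu, true_and]
      tauto
    have h5 := (card_le_card h4).trans (card_union_le _ _)
    have h6 := card_union_le (W.filter (fun u => E true w u)) (W.filter (fun u => E false w u))
    omega
  obtain ⟨c, hc⟩ := hc
  set A := W.filter (fun u => K c u = K c w) with hA
  have hsub : W.filter (fun u => E c w u) ⊆ A := by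
    intro u hu
    rw [Finset.mem_filter] at hu
    rw [hA, Finset.mem_filter]
    exact ⟨hu.1, (hK c w u hu.2).symm⟩
  have hAd : d < A.card := lt_of_lt_of_le hc (card_le_card hsub)
  by_cases hB : (W \ A).card ≤ 2 * d
  · obtain ⟨u, hu⟩ : (W.filter (fun u => E c w u)).Nonempty := card_pos.1 (by omega)
    refine ⟨c, w, u, hw, (Finset.mem_filter.1 hu).2, A, filter_subset _ _, ?_,
      fun a ha => (Finset.mem_filter.1 ha).2⟩
    have := card_sdiff_add_card_eq_card (show A ⊆ W from filter_subset _ _)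
    omega
  · push Not at hB
    have hnot : ∀ a ∈ A, ∀ b ∈ W \ A, ¬ E c a b := by
      intro a ha b hb hE
      rw [Finset.mem_sdiff] at hb
      apply hb.2
      rw [hA, Finset.mem_filter] at ha ⊢
      exact ⟨hb.1, (hK c a b hE).symm.trans ha.2⟩
    have hAW : ∀ a ∈ A, a ∈ W := fun a ha => (Finset.mem_filter.1 ha).1
    have hmiss : ∀ a ∈ A, ((W \ A).filter (fun b => ¬ E (!c) a b)).card ≤ d := by
      intro a ha
      apply hd' c a (hAW a ha)
      intro u hu
      rw [Finset.mem_filter] at hu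
      exact ⟨hnot a ha u hu.1, hu.2⟩
    have hAA : ∀ a ∈ A, ∀ a' ∈ A, ∃ b ∈ W \ A, E (!c) a b ∧ E (!c) a' b := by
      intro a ha a' ha'
      by_contra hcon
      push Not at hcon
      have h4 : W \ A ⊆ (W \ A).filter (fun b => ¬ E (!c) a b) ∪
          (W \ A).filter (fun b => ¬ E (!c) a' b) := by
        intro b hb
        have := hcon b hb
        simp only [Finset.mem_union, Finset.mem_filter, hb, true_and]
        tauto
      have h5 := (card_le_card h4).trans (card_union_le _ _)
      have := hmiss a ha
      have := hmiss a' ha'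
      omega
    have hwA : w ∈ A := by rw [hA, Finset.mem_filter]; exact ⟨hw, rfl⟩
    obtain ⟨u, hu, hwu, _⟩ := hAA w hwA w hwA
    refine ⟨!c, w, u, hw, hwu, W, Finset.Subset.refl _, by omega, ?_⟩
    have key : ∀ a ∈ A, K (!c) a = K (!c) w := by
      intro a ha
      obtain ⟨b, hb, h1, h2⟩ := hAA a ha w hwA
      exact (hK _ _ _ h1).trans (hK _ _ _ h2).symm
    intro b hb
    by_cases hbA : b ∈ A
    · exact key b hbA
    have hex : ∃ a ∈ A, E (!c) a b := by
      by_contra hcon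
      push Not at hcon
      have : A.card ≤ d := by
        apply hd' c b hb
        intro a ha
        exact ⟨fun h => hnot a ha b (Finset.mem_sdiff.2 ⟨hb, hbA⟩) (hsym _ _ _ h),
          fun h => hcon a ha (hsym _ _ _ h)⟩
      omega
    obtain ⟨a, ha, hab⟩ := hex
    exact (hK _ _ _ hab).symm.trans (key a ha)

lemma popular {α κ : Type*} [Nonempty κ] [DecidableEq κ] (X : Finset α) (f : α → κ) (B : ℝ)
    (h : (((X ×ˢ X).filter (fun p => f p.1 ≠ f p.2)).card : ℝ) ≤ B) :
    ∃ c, ((X.filter (fun x => f x ≠ c)).card : ℝ) ^ 2 ≤ B := by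
  rcases X.eq_empty_or_nonempty with rfl | hne
  · exact ⟨Classical.arbitrary κ, by simpa using h⟩
  obtain ⟨x0, hx0, hmin⟩ := exists_min_image X (fun x => (X.filter (fun y => f y ≠ f x)).card) hne
  refine ⟨f x0, le_trans ?_ h⟩
  have h1 : ((X ×ˢ X).filter (fun p => f p.1 ≠ f p.2)).card =
      ∑ x ∈ X, (X.filter (fun y => f y ≠ f x)).card := by
    rw [card_filter, sum_product]
    apply sum_congr rfl
    intro x _
    rw [card_filter]
    apply sum_congr rfl
    intro y _
    simp only [ne_comm]
  have h2 : X.card * (X.filter (fun y => f y ≠ f x0)).card ≤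
      ∑ x ∈ X, (X.filter (fun y => f y ≠ f x)).card := by
    rw [← smul_eq_mul]
    exact card_nsmul_le_sum _ _ _ hmin
  have h3 : (X.filter (fun y => f y ≠ f x0)).card ≤ X.card := card_filter_le _ _
  have h4 : (X.filter (fun y => f y ≠ f x0)).card ^ 2 ≤
      ((X ×ˢ X).filter (fun p => f p.1 ≠ f p.2)).card := by
    rw [h1, sq]; exact (Nat.mul_le_mul_right _ h3).trans h2
  exact_mod_cast h4

lemma popular2 [Fintype V] {κ : Type*} [Nonempty κ] [DecidableEq κ] (X : Finset V) (col : V → Bool)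
    (f : V → κ) (N : V → V → Prop) [∀ x, DecidablePred (N x)] (d : ℝ)
    (hd : ∀ x ∈ X, ((univ.filter (fun y => ¬ N x y)).card : ℝ) ≤ d) (hd0 : 0 ≤ d)
    (hN : ∀ x ∈ X, ∀ y ∈ X, col x = col y → N x y → N y x → f x = f y) :
    ∃ C : Bool → κ, ((X.filter (fun x => f x ≠ C (col x))).card : ℝ) ≤
      2 * Real.sqrt (2 * d * Fintype.card V) := by
  have h1 : ∀ c : Bool, ∃ C : κ,
      (((X.filter (fun x => col x = c)).filter (fun x => f x ≠ C)).card : ℝ) ^ 2 ≤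
        2 * d * Fintype.card V := by
    intro c
    apply popular
    set Y := X.filter (fun x => col x = c) with hY
    have hYX : Y ⊆ X := filter_subset _ _
    have hsub : (Y ×ˢ Y).filter (fun p => f p.1 ≠ f p.2) ⊆
        (Y ×ˢ Y).filter (fun p => ¬ N p.1 p.2) ∪ (Y ×ˢ Y).filter (fun p => ¬ N p.2 p.1) := by
      rintro ⟨x, y⟩ hp
      simp only [Finset.mem_union, Finset.mem_filter, Finset.mem_product] at hp ⊢
      by_contra hcon
      have hx := Finset.mem_filter.1 hp.1.1
      have hy := Finset.mem_filter.1 hp.1.2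
      apply hp.2
      apply hN x hx.1 y hy.1 (hx.2.trans hy.2.symm) <;> tauto
    have hbd : ∀ x ∈ Y, ((Y.filter (fun y => ¬ N x y)).card : ℝ) ≤ d := by
      intro x hx
      refine le_trans ?_ (hd x (hYX hx))
      exact_mod_cast card_le_card (filter_subset_filter _ (subset_univ _))
    have hYn : (Y.card : ℝ) ≤ Fintype.card V := by exact_mod_cast card_le_univ Y
    have hc1 : (((Y ×ˢ Y).filter (fun p => ¬ N p.1 p.2)).card : ℝ) ≤ Fintype.card V * d := by
      have : ((Y ×ˢ Y).filter (fun p => ¬ N p.1 p.2)).card =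
          ∑ x ∈ Y, (Y.filter (fun y => ¬ N x y)).card := by
        rw [card_filter, sum_product]
        apply sum_congr rfl
        intro x _
        rw [card_filter]
      rw [this]
      push_cast
      calc _ ≤ ∑ x ∈ Y, d := sum_le_sum hbd
        _ = Y.card * d := by simp
        _ ≤ _ := by gcongr
    have hc2 : (((Y ×ˢ Y).filter (fun p => ¬ N p.2 p.1)).card : ℝ) ≤ Fintype.card V * d := by
      have : ((Y ×ˢ Y).filter (fun p => ¬ N p.2 p.1)).card =
          ∑ x ∈ Y, (Y.filter (fun y => ¬ N x y)).card := by
        rw [card_filter, sum_product_right]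
        apply sum_congr rfl
        intro x _
        rw [card_filter]
      rw [this]
      push_cast
      calc _ ≤ ∑ x ∈ Y, d := sum_le_sum hbd
        _ = Y.card * d := by simp
        _ ≤ _ := by gcongr
    have h5 : (((Y ×ˢ Y).filter (fun p => f p.1 ≠ f p.2)).card : ℝ) ≤
        ((Y ×ˢ Y).filter (fun p => ¬ N p.1 p.2)).card +
          ((Y ×ˢ Y).filter (fun p => ¬ N p.2 p.1)).card := by
      exact_mod_cast (card_le_card hsub).trans (card_union_le _ _)
    linarith
  choose C hC using h1
  refine ⟨C, ?_⟩
  have hsub : X.filter (fun x => f x ≠ C (col x)) ⊆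
      (X.filter (fun x => col x = true)).filter (fun x => f x ≠ C true) ∪
      (X.filter (fun x => col x = false)).filter (fun x => f x ≠ C false) := by
    intro x hx
    simp only [Finset.mem_union, Finset.mem_filter] at hx ⊢
    cases hcx : col x
    · right; rw [hcx] at hx; exact ⟨⟨hx.1, rfl⟩, hx.2⟩
    · left; rw [hcx] at hx; exact ⟨⟨hx.1, rfl⟩, hx.2⟩
  have h5 : ((X.filter (fun x => f x ≠ C (col x))).card : ℝ) ≤
      ((X.filter (fun x => col x = true)).filter (fun x => f x ≠ C true)).card +
      ((X.filter (fun x => col x = false)).filter (fun x => f x ≠ C false)).card := by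
    exact_mod_cast (card_le_card hsub).trans (card_union_le _ _)
  have := Real.le_sqrt_of_sq_le (hC true)
  have := Real.le_sqrt_of_sq_le (hC false)
  linarith
end helpers

section cleaning

variable {V : Type*} [Fintype V] [DecidableEq V]

open Classical in
/-- Bad sets of codimension `m`. -/
noncomputable def badSets (t : ℝ) (G : Finset (Finset V)) : ℕ → Finset V → Prop
  | 0, S => S ∉ G
  | m + 1, S => t ≤ ((univ.filter (fun v => v ∉ S ∧ badSets t G m (insert v S))).card : ℝ)

lemma badSets_succ (t : ℝ) (G : Finset (Finset V)) (m : ℕ) (S : Finset V)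
    [DecidablePred (fun v => v ∉ S ∧ badSets t G m (insert v S))] :
    badSets t G (m + 1) S ↔
      t ≤ ((univ.filter (fun v => v ∉ S ∧ badSets t G m (insert v S))).card : ℝ) := by
  rw [badSets]
  have : ∀ i1 i2 : DecidablePred (fun v => v ∉ S ∧ badSets t G m (insert v S)),
    (@Finset.filter _ (fun v => v ∉ S ∧ badSets t G m (insert v S)) i1 univ).card =
    (@Finset.filter _ (fun v => v ∉ S ∧ badSets t G m (insert v S)) i2 univ).card := by
    intro i1 i2; congr
  rw [this]

/-- Sets all of whose subsets are not bad. -/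
def goodSet (t : ℝ) (G : Finset (Finset V)) (r : ℕ) (S : Finset V) : Prop :=
  ∀ S' ⊆ S, ¬ badSets t G (r - S'.card) S'

open Classical in
lemma bad_count_step (t : ℝ) (G : Finset (Finset V)) (r m : ℕ) (hm : m < r) :
    t * (((univ : Finset V).powersetCard (r - (m + 1))).filter (badSets t G (m + 1))).card ≤
      ((r - m : ℕ) : ℝ) * (((univ : Finset V).powersetCard (r - m)).filter (badSets t G m)).card := by
  set P := ((univ : Finset V).powersetCard (r - (m + 1))).filter (badSets t G (m + 1)) with hP
  set Q := ((univ : Finset V).powersetCard (r - m)).filter (badSets t G m) with hQ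
  have h1 : (P.sigma (fun S => univ.filter (fun v => v ∉ S ∧ badSets t G m (insert v S)))).card ≤
      (Q.sigma (fun U => U)).card := by
    apply card_le_card_of_injOn (fun p => ⟨insert p.2 p.1, p.2⟩)
    · rintro ⟨S, v⟩ hp
      simp only [Finset.coe_sigma, Set.mem_sigma_iff, Finset.mem_coe, Finset.mem_filter,
        Finset.mem_powersetCard, hP, hQ, Finset.mem_univ, true_and, subset_univ] at hp ⊢
      refine ⟨⟨?_, hp.2.2⟩, mem_insert_self _ _⟩
      rw [card_insert_of_notMem hp.2.1, hp.1.1]; omega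
    · rintro ⟨S, v⟩ hp ⟨S', v'⟩ hp' heq
      simp only [Finset.coe_sigma, Set.mem_sigma_iff, Finset.mem_coe, Finset.mem_filter,
        Finset.mem_univ, true_and] at hp hp'
      simp only [Sigma.mk.injEq, heq_eq_eq] at heq
      obtain ⟨h1, rfl⟩ := heq
      have : S = S' := by
        rw [← erase_insert hp.2.1, h1, erase_insert hp'.2.1]
      subst this; rfl
  rw [card_sigma, card_sigma] at h1
  have h2 : ∑ U ∈ Q, U.card = (r - m) * Q.card := by
    rw [sum_const_nat (m := r - m), mul_comm]
    intro U hU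
    exact (Finset.mem_powersetCard.1 (Finset.mem_filter.1 hU).1).2
  rw [h2] at h1
  have h3 : (P.card : ℝ) * t ≤
      ∑ S ∈ P, ((univ.filter (fun v => v ∉ S ∧ badSets t G m (insert v S))).card : ℝ) := by
    rw [← nsmul_eq_mul]
    apply card_nsmul_le_sum
    intro S hS
    exact (badSets_succ t G m S).1 (Finset.mem_filter.1 hS).2
  have h4 : ∑ S ∈ P, ((univ.filter (fun v => v ∉ S ∧ badSets t G m (insert v S))).card : ℝ) ≤
    ((r - m : ℕ) : ℝ) * Q.card := by exact_mod_cast h1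
  linarith

open Classical in
lemma bad_count (t : ℝ) (ht : 0 ≤ t) (G : Finset (Finset V)) (r m : ℕ) (hm : m ≤ r) :
    t ^ m * ((r - m).factorial : ℝ) *
      (((univ : Finset V).powersetCard (r - m)).filter (badSets t G m)).card ≤
      (r.factorial : ℝ) * (((univ : Finset V).powersetCard r).filter (badSets t G 0)).card := by
  induction m with
  | zero => simp
  | succ m ih =>
    have h1 := ih (by omega)
    have h2 := bad_count_step t G r m (by omega)
    refine le_trans ?_ h1
    have h3 : ((r - m).factorial : ℝ) = ((r - m : ℕ) : ℝ) * ((r - (m + 1)).factorial : ℝ) := by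
      rw [show r - m = r - (m + 1) + 1 by omega, Nat.factorial_succ]; push_cast; ring
    rw [h3]
    have h4 := mul_le_mul_of_nonneg_left h2
      (show 0 ≤ t ^ m * ((r - (m + 1)).factorial : ℝ) by positivity)
    rw [pow_succ]
    linarith

lemma good_mono {t : ℝ} {G : Finset (Finset V)} {r : ℕ} {S S' : Finset V}
    (h : goodSet t G r S) (hs : S' ⊆ S) : goodSet t G r S' :=
  fun U hU => h U (hU.trans hs)

open Classical in
lemma good_ext (t : ℝ) (ht : 0 ≤ t) (G : Finset (Finset V)) (r : ℕ) (S : Finset V)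
    (hS : goodSet t G r S) (hr : S.card < r) :
    (Fintype.card V : ℝ) - r - 2 ^ r * t ≤
      ((univ.filter (fun v => v ∉ S ∧ goodSet t G r (insert v S))).card : ℝ) := by
  set A := univ.filter (fun v => v ∉ S ∧ goodSet t G r (insert v S)) with hA
  set B := S.powerset.biUnion (fun U => univ.filter
    (fun v => v ∉ U ∧ badSets t G (r - U.card - 1) (insert v U))) with hB
  have hcov : (univ : Finset V) ⊆ A ∪ S ∪ B := by
    intro v _
    by_cases hvS : v ∈ S
    · simp [hvS]
    by_cases hg : goodSet t G r (insert v S)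
    · simp [hA, hvS, hg]
    unfold goodSet at hg
    push Not at hg
    obtain ⟨S', hS', hbad⟩ := hg
    have hv : v ∈ S' := by
      by_contra hv
      exact hS S' ((subset_insert_iff_of_notMem hv).1 hS') hbad
    rw [Finset.mem_union]
    right
    rw [hB, Finset.mem_biUnion]
    refine ⟨S'.erase v, ?_, ?_⟩
    · rw [Finset.mem_powerset]; exact subset_insert_iff.1 hS'
    · rw [Finset.mem_filter]
      refine ⟨mem_univ _, notMem_erase _ _, ?_⟩
      rw [insert_erase hv, card_erase_of_mem hv]
      have : 1 ≤ S'.card := card_pos.2 ⟨v, hv⟩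
      rw [show r - (S'.card - 1) - 1 = r - S'.card by omega]
      exact hbad
  have hBc : (B.card : ℝ) ≤ 2 ^ r * t := by
    have h1 : (B.card : ℝ) ≤ ∑ U ∈ S.powerset, ((univ.filter
      (fun v => v ∉ U ∧ badSets t G (r - U.card - 1) (insert v U))).card : ℝ) := by
      exact_mod_cast card_biUnion_le
    refine h1.trans ?_
    have h2 : ∀ U ∈ S.powerset, ((univ.filter
      (fun v => v ∉ U ∧ badSets t G (r - U.card - 1) (insert v U))).card : ℝ) ≤ t := by
      intro U hU
      rw [Finset.mem_powerset] at hU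
      have h3 := hS U hU
      have h4 := card_le_card hU
      rw [show r - U.card = r - U.card - 1 + 1 by omega, badSets_succ] at h3
      exact (not_le.1 h3).le
    refine (sum_le_sum h2).trans ?_
    rw [sum_const, card_powerset, nsmul_eq_mul]
    push_cast
    gcongr
    · norm_num
  have h1 := (card_le_card hcov).trans (card_union_le _ _)
  have h2 := card_union_le A S
  rw [card_univ] at h1
  have h3 : (Fintype.card V : ℝ) ≤ A.card + S.card + B.card := by exact_mod_cast (by omega)
  have h4 : (S.card : ℝ) ≤ r := by exact_mod_cast hr.le
  linarith

open Classical in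
lemma good_count (t : ℝ) (ht : 0 ≤ t) (G : Finset (Finset V)) (r : ℕ) (L : ℝ) (hL0 : 0 ≤ L)
    (hL : L ≤ (Fintype.card V : ℝ) - r - 2 ^ r * t) (j : ℕ) (S : Finset V)
    (hS : goodSet t G r S) (hr : S.card + j ≤ r) :
    L ^ j ≤ (j.factorial : ℝ) *
      ((univ.filter (fun U => S ⊆ U ∧ U.card = S.card + j ∧ goodSet t G r U)).card : ℝ) := by
  induction j generalizing S with
  | zero =>
    have : (univ.filter (fun U => S ⊆ U ∧ U.card = S.card + 0 ∧ goodSet t G r U)).Nonempty :=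
      ⟨S, by simp [hS]⟩
    have := card_pos.2 this
    simp only [pow_zero, Nat.factorial_zero, Nat.cast_one, one_mul]
    exact_mod_cast this
  | succ j ih =>
    set A := univ.filter (fun v => v ∉ S ∧ goodSet t G r (insert v S)) with hA
    set Q := univ.filter (fun U => S ⊆ U ∧ U.card = S.card + (j + 1) ∧ goodSet t G r U) with hQ
    have hAc : L ≤ A.card := hL.trans (good_ext t ht G r S hS (by omega))
    have h1 : (A.sigma (fun v => univ.filter (fun U => insert v S ⊆ U ∧
        U.card = (insert v S).card + j ∧ goodSet t G r U))).card ≤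
        (Q.sigma (fun U => U \ S)).card := by
      apply card_le_card_of_injOn (fun p => ⟨p.2, p.1⟩)
      · rintro ⟨v, U⟩ hp
        simp only [Finset.coe_sigma, Set.mem_sigma_iff, Finset.mem_coe, Finset.mem_filter,
          hA, hQ, Finset.mem_univ, true_and, Finset.mem_sdiff] at hp ⊢
        obtain ⟨⟨hv, _⟩, hsub, hc, hg⟩ := hp
        rw [card_insert_of_notMem hv] at hc
        exact ⟨⟨(subset_insert _ _).trans hsub, by omega, hg⟩, hsub (mem_insert_self _ _), hv⟩
      · rintro ⟨v, U⟩ hp ⟨v', U'⟩ hp' heq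
        simp only [Sigma.mk.injEq, heq_eq_eq] at heq
        obtain ⟨rfl, rfl⟩ := heq
        rfl
    rw [card_sigma, card_sigma] at h1
    have h2 : ∑ U ∈ Q, (U \ S).card = Q.card * (j + 1) := by
      apply sum_const_nat
      intro U hU
      rw [hQ, Finset.mem_filter] at hU
      rw [card_sdiff_of_subset hU.2.1]; omega
    rw [h2] at h1
    have h3 : ∀ v ∈ A, L ^ j ≤ (j.factorial : ℝ) * ((univ.filter (fun U => insert v S ⊆ U ∧
        U.card = (insert v S).card + j ∧ goodSet t G r U)).card : ℝ) := by
      intro v hv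
      rw [hA, Finset.mem_filter] at hv
      apply ih (insert v S) hv.2.2
      rw [card_insert_of_notMem hv.2.1]; omega
    have h4 := card_nsmul_le_sum A _ _ h3
    rw [nsmul_eq_mul, ← mul_sum] at h4
    have h5 : ∑ v ∈ A, ((univ.filter (fun U => insert v S ⊆ U ∧
        U.card = (insert v S).card + j ∧ goodSet t G r U)).card : ℝ) ≤ Q.card * (j + 1) := by
      exact_mod_cast h1
    calc L ^ (j + 1) = L * L ^ j := by ring
      _ ≤ A.card * L ^ j := by gcongr
      _ ≤ _ := h4
      _ ≤ (j.factorial : ℝ) * (Q.card * (j + 1)) := by gcongr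
      _ = _ := by rw [Nat.factorial_succ]; push_cast; ring

open Classical in
lemma good_count' (t : ℝ) (ht : 0 ≤ t) (G : Finset (Finset V)) (r : ℕ) (l : ℝ) (hL0 : 0 ≤ l)
    (hL : l * Fintype.card V ≤ (Fintype.card V : ℝ) - r - 2 ^ r * t) (j : ℕ) (S : Finset V)
    (hS : goodSet t G r S) (hr : S.card + j ≤ r) :
    l ^ j * (Fintype.card V).choose j ≤
      ((univ.filter (fun U => S ⊆ U ∧ U.card = S.card + j ∧ goodSet t G r U)).card : ℝ) := by
  have h1 := good_count t ht G r _ (by positivity) hL j S hS hr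
  have h2 : ((Fintype.card V).choose j : ℝ) * (j.factorial : ℝ) ≤ (Fintype.card V : ℝ) ^ j := by
    have := Nat.choose_le_pow_div (α := ℝ) j (Fintype.card V)
    rwa [le_div_iff₀ (by positivity)] at this
  have h3 : (0 : ℝ) < (j.factorial : ℝ) := by positivity
  refine le_of_mul_le_mul_left ?_ h3
  refine le_trans ?_ h1
  rw [mul_pow]
  have := mul_le_mul_of_nonneg_left h2 (show 0 ≤ l ^ j by positivity)
  linarith

lemma cleaning (r : ℕ) (hr : 2 ≤ r) (η β : ℝ) (hη : 0 < η) (hη1 : η ≤ 1)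
    (hβ : β < (η / (2 ^ (r + 1) * r)) ^ r)
    (hn : 2 * (r : ℝ) ^ 2 / η ≤ Fintype.card V) (G1 : Finset (Finset V))
    (hG : ((((univ : Finset V).powersetCard r) \ G1).card : ℝ) ≤ β * (Fintype.card V).choose r) :
    ∃ G ⊆ G1, (∀ e ∈ G, e.card = r) ∧ IsDense r G (1 - η) η := by
  classical
  set n := Fintype.card V with hndef
  have hr0 : (0 : ℝ) < r := by positivity
  have hn0 : (0 : ℝ) < n := lt_of_lt_of_le (by positivity) hn
  set θ := η / (2 ^ (r + 1) * r) with hθ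
  have hθ0 : 0 < θ := by positivity
  set t := θ * n with ht
  have ht0 : 0 < t := by positivity
  have h2t : 2 ^ r * t = η / (2 * r) * n := by
    rw [ht, hθ, pow_succ]; field_simp
  have hrn : (r : ℝ) ≤ η / (2 * r) * n := by
    rw [div_le_iff₀ hη] at hn
    rw [div_mul_eq_mul_div, le_div_iff₀ (by positivity)]
    nlinarith
  set l := 1 - η / r with hl
  have hηr : η / r ≤ 1 := by
    rw [div_le_one hr0]
    have : (2 : ℝ) ≤ r := by exact_mod_cast hr
    linarith
  have hl0 : 0 ≤ l := by linarith
  have hl1 : l ≤ 1 := by have : 0 < η / r := by positivity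
                         linarith
  have hL : l * n ≤ (n : ℝ) - r - 2 ^ r * t := by
    rw [h2t, hl]
    have : η / r * n = η / (2 * r) * n + η / (2 * r) * n := by field_simp; ring
    nlinarith
  have hlj : ∀ j ≤ r, 1 - η ≤ l ^ j := by
    intro j hj
    calc 1 - η = 1 + (r : ℝ) * (-(η / r)) := by field_simp; ring
      _ ≤ (1 + (-(η / r))) ^ r := one_add_mul_le_pow (by linarith) r
      _ = l ^ r := by rw [hl]; ring
      _ ≤ l ^ j := pow_le_pow_of_le_one hl0 hl1 hj
  have hempty : goodSet t G1 r ∅ := by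
    intro S' hS' hbad
    rw [subset_empty] at hS'
    subst hS'
    have h1 := bad_count t ht0.le G1 r r le_rfl
    simp only [Nat.sub_self, powersetCard_zero] at h1
    rw [card_empty, Nat.sub_zero] at hbad
    rw [filter_singleton, if_pos hbad] at h1
    have h2 : ((univ : Finset V).powersetCard r).filter (badSets t G1 0) =
        ((univ : Finset V).powersetCard r) \ G1 := by
      ext S; rw [Finset.mem_filter, Finset.mem_sdiff, badSets]
    rw [h2] at h1
    simp only [Nat.factorial_zero, card_singleton, Nat.cast_one, mul_one] at h1
    have h3 : (n.choose r : ℝ) * (r.factorial : ℝ) ≤ (n : ℝ) ^ r := by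
      have := Nat.choose_le_pow_div (α := ℝ) r n
      rwa [le_div_iff₀ (by positivity)] at this
    have h4 : (0 : ℝ) < (r.factorial : ℝ) := by positivity
    have hβ0 : 0 ≤ β := by
      by_contra hc
      push Not at hc
      have h6 : (0 : ℝ) ≤ ((((univ : Finset V).powersetCard r) \ G1).card : ℝ) := by positivity
      have h7 : (0 : ℝ) < θ ^ r * n ^ r := by positivity
      rw [ht, mul_pow] at h1
      have h8 : β * (n.choose r : ℝ) ≤ 0 := mul_nonpos_of_nonpos_of_nonneg hc.le (by positivity)
      have h9 := mul_le_mul_of_nonneg_left (hG.trans h8) h4.le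
      linarith
    have h5 : t ^ r ≤ β * (n : ℝ) ^ r := by
      calc t ^ r ≤ _ := h1
        _ ≤ (r.factorial : ℝ) * (β * n.choose r) := by gcongr
        _ = β * (n.choose r * (r.factorial : ℝ)) := by ring
        _ ≤ _ := by gcongr
    rw [ht, mul_pow] at h5
    have h6 : (0 : ℝ) < (n : ℝ) ^ r := by positivity
    have := le_of_mul_le_mul_right h5 h6
    linarith
  set G := univ.filter (fun U : Finset V => U.card = r ∧ goodSet t G1 r U) with hGdef
  have hGood : ∀ S : Finset V, S.card < r → goodSet t G1 r S →
      (1 - η) * n.choose (r - S.card) ≤ (degT r G S : ℝ) := by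
    intro S hS hg
    have h1 := good_count' t ht0.le G1 r l hl0 hL (r - S.card) S hg (by omega)
    have h2 := mul_le_mul_of_nonneg_right (hlj (r - S.card) (by omega))
      (show (0 : ℝ) ≤ n.choose (r - S.card) by positivity)
    refine h2.trans (h1.trans ?_)
    unfold degT degOn
    norm_cast
    apply card_le_card_of_injOn (fun U => U \ S)
    · intro U hU
      simp only [Finset.coe_filter, Finset.mem_univ, true_and, Set.mem_ofPred_eq,
        Finset.mem_powersetCard, subset_univ, hGdef, Finset.mem_filter] at hU ⊢
      rw [card_sdiff_of_subset hU.1, sdiff_union_of_subset hU.1]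
      exact ⟨by omega, by omega, hU.2.2⟩
    · intro U hU U' hU' heq
      simp only [Finset.coe_filter, Finset.mem_univ, true_and, Set.mem_ofPred_eq] at hU hU'
      simp only at heq
      rw [← sdiff_union_of_subset hU.1, heq, sdiff_union_of_subset hU'.1]
  refine ⟨G, ?_, ?_, ?_⟩
  · intro U hU
    rw [hGdef, Finset.mem_filter] at hU
    have := hU.2.2 U (Finset.Subset.refl _)
    rw [hU.2.1, Nat.sub_self] at this
    simpa [badSets] using this
  · intro U hU
    rw [hGdef, Finset.mem_filter] at hU
    exact hU.2.1
  · intro i hi1 hir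
    refine ⟨?_, ?_⟩
    · have h1 := good_count' t ht0.le G1 r l hl0 hL i ∅ hempty (by simp; omega)
      have h2 := mul_le_mul_of_nonneg_right (hlj i (by omega))
        (show (0 : ℝ) ≤ n.choose i by positivity)
      have h3 := h2.trans h1
      simp only [card_empty, zero_add, empty_subset, true_and] at h3
      set P := univ.filter (fun U : Finset V => U.card = i ∧ goodSet t G1 r U) with hP
      have h4 : P ⊆ (univ : Finset V).powersetCard i := by
        intro U hU
        rw [hP, Finset.mem_filter] at hU
        rw [Finset.mem_powersetCard]; exact ⟨subset_univ _, hU.2.1⟩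
      have h5 : {S : Finset V | S.card = i ∧ (degT r G S : ℝ) < (1 - η) * (n.choose (r - i))} ⊆
          ↑((univ : Finset V).powersetCard i \ P) := by
        rintro S ⟨hS, hd⟩
        rw [Finset.mem_coe, Finset.mem_sdiff, Finset.mem_powersetCard]
        refine ⟨⟨subset_univ _, hS⟩, ?_⟩
        intro hSP
        rw [hP, Finset.mem_filter] at hSP
        have := hGood S (by omega) hSP.2.2
        rw [hS] at this
        linarith
      have h6 := Set.ncard_le_ncard h5 (Finset.finite_toSet _)
      rw [Set.ncard_coe_finset] at h6
      have h7 := card_sdiff_add_card_eq_card h4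
      rw [card_powersetCard, card_univ] at h7
      have h8 : ((((univ : Finset V).powersetCard i) \ P).card : ℝ) + P.card = n.choose i := by
        exact_mod_cast h7
      have h9 : (({S : Finset V | S.card = i ∧
        (degT r G S : ℝ) < (1 - η) * (n.choose (r - i))}.ncard : ℕ) : ℝ) ≤
        ((((univ : Finset V).powersetCard i) \ P).card : ℝ) := by exact_mod_cast h6
      linarith
    · intro S hS hd
      have hng : ¬ goodSet t G1 r S := by
        intro hg
        have := hGood S (by omega) hg
        rw [hS] at this
        linarith
      unfold degT degOn
      rw [card_eq_zero, filter_eq_empty_iff]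
      intro e _ he
      rw [hGdef, Finset.mem_filter] at he
      exact hng (good_mono he.2.2 subset_union_right)

end cleaning

section main

variable {V : Type*} [Fintype V] [DecidableEq V]

lemma degT_one (k : ℕ) (hk : 1 ≤ k) (H : Finset (Finset V)) (F : Finset V) (hF : F.card = k - 1) :
    degT k H F = (univ.filter (fun u => insert u F ∈ H)).card := by
  unfold degT degOn
  rw [hF, show k - (k - 1) = 1 by omega]
  symm
  apply card_bij (fun u _ => ({u} : Finset V))
  · intro u hu
    rw [Finset.mem_filter] at hu ⊢
    refine ⟨by simp [Finset.mem_powersetCard], ?_⟩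
    rw [singleton_union]; exact hu.2
  · intro a _ b _ h
    exact singleton_injective h
  · intro e he
    rw [Finset.mem_filter, Finset.mem_powersetCard] at he
    obtain ⟨u, rfl⟩ := card_eq_one.1 he.1.2
    refine ⟨u, ?_, rfl⟩
    rw [Finset.mem_filter]
    refine ⟨mem_univ _, ?_⟩
    rw [← singleton_union]; exact he.2

lemma per_set (k : ℕ) (hk : 4 ≤ k) (ε : ℝ) (hε : 0 < ε) (hε1 : ε ≤ 1 / 10)
    (hn : 2 ≤ Fintype.card V) (H : Finset (Finset V)) (cH : Finset V → Bool)
    (hu : ∀ e ∈ H, e.card = k)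
    (h1 : ∀ F : Finset V, F.card = k - 1 → degT k H F ≠ 0 →
      (1 - ε) * Fintype.card V ≤ (degT k H F : ℝ))
    (S : Finset V) (hS : S.card = k - 2)
    (h2 : (1 - ε) * (Fintype.card V).choose 2 ≤ (degT k H S : ℝ)) :
    ∃ c : Bool, ∃ C : Finset (Finset V), IsTightComponent k (H.filter (fun f => cH f = c)) C ∧
      C.Nonempty ∧ ∃ A : Finset V, (1 - 3 * ε) * Fintype.card V ≤ (A.card : ℝ) ∧
        ∀ w ∈ A, w ∉ S ∧ KK k (H.filter (fun f => cH f = c)) (insert w S) = C := by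
  classical
  set n := Fintype.card V with hndef
  have hn2 : (2 : ℝ) ≤ n := by exact_mod_cast hn
  set W := univ.filter (fun w => w ∉ S ∧ degT k H (insert w S) ≠ 0) with hW
  have hcI : ∀ w, w ∉ S → (insert w S).card = k - 1 := by
    intro w hw
    rw [card_insert_of_notMem hw, hS]; omega
  have hWn : (W.card : ℝ) ≤ n := by exact_mod_cast card_le_univ W
  have hWc : (1 - ε) * n ≤ W.card := by
    have ha : degT k H S ≤ W.card.choose 2 := by
      rw [← card_powersetCard]
      unfold degT degOn
      apply card_le_card
      intro e he
      rw [hS, show k - (k - 2) = 2 by omega, Finset.mem_filter, Finset.mem_powersetCard] at he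
      obtain ⟨⟨_, hec⟩, heH⟩ := he
      rw [Finset.mem_powersetCard]
      refine ⟨?_, hec⟩
      have hdis : Disjoint e S := by
        rw [← card_union_eq_card_add_card, hu _ heH, hec, hS]; omega
      intro w hw
      have hwS : w ∉ S := disjoint_left.1 hdis hw
      rw [hW, Finset.mem_filter]
      refine ⟨mem_univ _, hwS, ?_⟩
      rw [degT_one k (by omega) H _ (hcI w hwS)]
      apply (card_pos.2 _).ne'
      obtain ⟨u, hu'⟩ := card_eq_one.1 (show (e.erase w).card = 1 by
        rw [card_erase_of_mem hw, hec])
      refine ⟨u, ?_⟩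
      rw [Finset.mem_filter]
      refine ⟨mem_univ _, ?_⟩
      have : insert u (insert w S) = e ∪ S := by
        rw [← insert_erase hw, hu']
        ext z; simp only [Finset.mem_insert, Finset.mem_union, Finset.mem_singleton]; tauto
      rw [this]; exact heH
    have hb : (1 - ε) * (n.choose 2 : ℝ) ≤ (W.card.choose 2 : ℝ) :=
      h2.trans (by exact_mod_cast ha)
    rw [Nat.cast_choose_two, Nat.cast_choose_two] at hb
    by_contra hcon
    push Not at hcon
    rcases Nat.eq_zero_or_pos W.card with h0 | h0
    · rw [h0] at hb
      have : 0 < (1 - ε) * ((n : ℝ) * (n - 1) / 2) := by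
        apply mul_pos (by linarith)
        apply div_pos (mul_pos (by linarith) (by linarith)) (by norm_num)
      simp at hb
      linarith
    · have h0' : (1 : ℝ) ≤ W.card := by exact_mod_cast h0
      have e1 : (W.card : ℝ) * (W.card - 1) ≤ (1 - ε) * n * (W.card - 1) :=
        mul_le_mul_of_nonneg_right hcon.le (by linarith)
      have e2 : (W.card : ℝ) < n := by nlinarith
      have e3 : (1 - ε) * n * ((W.card : ℝ) - 1) < (1 - ε) * n * (n - 1) :=
        mul_lt_mul_of_pos_left (by linarith) (mul_pos (by linarith) (by linarith))
      nlinarith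
  set d := ⌊ε * n⌋₊ with hd
  have hdle : (d : ℝ) ≤ ε * n := Nat.floor_le (by positivity)
  have hHu : ∀ c : Bool, ∀ e ∈ H.filter (fun f => cH f = c), e.card = k :=
    fun c e he => hu e (Finset.mem_filter.1 he).1
  obtain ⟨c, w, u, hwW, hE, A, hAW, hAc, hA⟩ := link_lemma W d
    (fun c w u => w ∉ S ∧ u ∉ S ∧ insert w (insert u S) ∈ H.filter (fun f => cH f = c))
    (fun c w => KK k (H.filter (fun f => cH f = c)) (insert w S))
    (by
      have : (3 : ℝ) * d < W.card := by nlinarith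
      exact_mod_cast this)
    (by
      rintro c x y ⟨hx, hy, he⟩
      exact ⟨hy, hx, by rw [Finset.insert_comm]; exact he⟩)
    (by
      rintro c x y ⟨hx, hy, he⟩
      refine KK_eq (hHu c) (by omega) (hcI x hx) (hcI y hy) he ?_ (subset_insert _ _)
      exact insert_subset_insert _ (subset_insert _ _))
    (by
      intro w hw U hU
      rw [hW, Finset.mem_filter] at hw
      have hw1 := h1 _ (hcI w hw.2.1) hw.2.2
      rw [degT_one k (by omega) H _ (hcI w hw.2.1)] at hw1
      have hdis : Disjoint U (univ.filter (fun u => insert u (insert w S) ∈ H)) := by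
        rw [disjoint_left]
        intro u huU hu'
        rw [Finset.mem_filter] at hu'
        have hk1 := hu _ hu'.2
        have huS : u ∉ S := by
          intro huS
          rw [insert_eq_of_mem (mem_insert_of_mem huS), hcI w hw.2.1] at hk1
          omega
        have := hU u huU
        have h3 := hu'.2
        rw [Finset.insert_comm] at h3
        cases hcol : cH (insert w (insert u S))
        · exact this.2 ⟨hw.2.1, huS, Finset.mem_filter.2 ⟨h3, hcol⟩⟩
        · exact this.1 ⟨hw.2.1, huS, Finset.mem_filter.2 ⟨h3, hcol⟩⟩
      have h4 := card_le_univ (U ∪ univ.filter (fun u => insert u (insert w S) ∈ H))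
      rw [card_union_of_disjoint hdis] at h4
      have h5 : (U.card : ℝ) + (univ.filter (fun u => insert u (insert w S) ∈ H)).card ≤ n := by
        exact_mod_cast h4
      apply Nat.le_floor
      linarith)
  obtain ⟨hwS, huS, hE⟩ := hE
  have hsub : insert w S ⊆ insert w (insert u S) := insert_subset_insert _ (subset_insert _ _)
  refine ⟨c, KK k (H.filter (fun f => cH f = c)) (insert w S),
    KK_comp (hHu c) (by omega) (hcI w hwS) hE hsub,
    ⟨_, (mem_KK (hHu c) (by omega) (hcI w hwS) hE hsub _).2 (tc_refl k _ hE)⟩, A, ?_, ?_⟩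
  · have : (W.card : ℝ) ≤ A.card + 2 * d := by exact_mod_cast hAc
    linarith
  · intro a ha
    exact ⟨(Finset.mem_filter.1 (hAW ha)).2.1, hA a ha⟩

lemma build (k : ℕ) (hk : 4 ≤ k) (ε α : ℝ) (hε : 0 < ε) (hε1 : ε ≤ 1 / 10)
    (hn : 2 * k ≤ Fintype.card V) (hα : 4 * (k : ℝ) * Real.sqrt (6 * ε) ≤ α)
    (H : Finset (Finset V)) (cH : Finset V → Bool)
    (hu : ∀ e ∈ H, e.card = k) (hH : IsDense k H (1 - ε) α) :
    ∃ (G : Finset (Finset V)) (col : Finset V → Bool) (comp : Finset V → Finset (Finset V)),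
      ((((univ : Finset V).powersetCard (k - 2)) \ G).card : ℝ) ≤
        2 * α * (Fintype.card V).choose (k - 2) ∧
      (∀ e ∈ G, IsTightComponent k (H.filter (fun f => cH f = col e)) (comp e)) ∧
      (∀ e ∈ G, (1 - 3 * ε) * (Fintype.card V : ℝ) ≤
        (degT (k - 1) (shadowTo (k - 1) (comp e)) e : ℝ)) ∧
      (∀ e ∈ G, ∀ e' ∈ G, col e = col e' → (e ∩ e').card = k - 3 → comp e = comp e') := by
  classical
  set n := Fintype.card V with hndef
  obtain ⟨hA1, -⟩ := hH (k - 2) (by omega) (by omega)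
  obtain ⟨-, hB2⟩ := hH (k - 1) (by omega) (by omega)
  rw [show k - (k - 2) = 2 by omega] at hA1
  simp only [show k - (k - 1) = 1 by omega, Nat.choose_one_right] at hB2
  have h1 : ∀ F : Finset V, F.card = k - 1 → degT k H F ≠ 0 →
      (1 - ε) * n ≤ (degT k H F : ℝ) := by
    intro F hF hne
    by_contra hc
    exact hne (hB2 F hF (not_le.1 hc))
  set G0 := ((univ : Finset V).powersetCard (k - 2)).filter
    (fun S => (1 - ε) * (n.choose 2 : ℝ) ≤ (degT k H S : ℝ)) with hG0
  have hG0c : ∀ S ∈ G0, S.card = k - 2 := fun S hS =>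
    (Finset.mem_powersetCard.1 (Finset.mem_filter.1 hS).1).2
  have hex : ∀ S : Finset V, ∃ c : Bool, ∃ C : Finset (Finset V), ∃ A : Finset V, S ∈ G0 →
      (IsTightComponent k (H.filter (fun f => cH f = c)) C ∧
      C.Nonempty ∧ (1 - 3 * ε) * n ≤ (A.card : ℝ) ∧
        ∀ w ∈ A, w ∉ S ∧ KK k (H.filter (fun f => cH f = c)) (insert w S) = C) := by
    intro S
    by_cases hS : S ∈ G0
    · obtain ⟨c, C, h3, h4, A, h5, h6⟩ := per_set k hk ε hε hε1 (by omega) H cH hu h1 S (hG0c S hS)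
        (Finset.mem_filter.1 hS).2
      exact ⟨c, C, A, fun _ => ⟨h3, h4, h5, h6⟩⟩
    · exact ⟨true, ∅, ∅, fun h => absurd h hS⟩
  choose col comp A hprop using hex
  have hpop : ∀ T : Finset V, ∃ C : Bool → Finset (Finset V),
      ((univ.filter (fun x => x ∉ T ∧ insert x T ∈ G0)).filter
        (fun x => comp (insert x T) ≠ C (col (insert x T)))).card ≤
        2 * Real.sqrt (2 * (3 * ε * n) * n) := by
    intro T
    apply popular2 (univ.filter (fun x => x ∉ T ∧ insert x T ∈ G0))
      (fun x => col (insert x T)) (fun x => comp (insert x T))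
      (fun x y => y ∈ A (insert x T)) (3 * ε * n)
    · intro x hx
      rw [Finset.mem_filter] at hx
      have h3 := (hprop _ hx.2.2).2.2.1
      have h4 : univ.filter (fun y => ¬ y ∈ A (insert x T)) = (A (insert x T))ᶜ := by
        ext y; simp
      rw [h4, card_compl, Nat.cast_sub (card_le_univ _)]
      linarith
    · positivity
    · intro x hx y hy hc hxy hyx
      rw [Finset.mem_filter] at hx hy
      have h3 := ((hprop _ hx.2.2).2.2.2 y hxy).2
      have h4 := ((hprop _ hy.2.2).2.2.2 x hyx).2
      rw [← h3, ← h4, hc, Finset.insert_comm]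
  choose C hC using hpop
  set G := G0.filter (fun S => ∀ x ∈ S, comp S = C (S.erase x) (col S)) with hG
  have hGG0 : G ⊆ G0 := filter_subset _ _
  refine ⟨G, col, comp, ?_, ?_, ?_, ?_⟩
  · have hs : ((univ : Finset V).powersetCard (k - 2)) \ G ⊆
        (((univ : Finset V).powersetCard (k - 2)) \ G0) ∪ (G0 \ G) := by
      intro S hS
      rw [Finset.mem_sdiff] at hS
      by_cases h : S ∈ G0
      · exact Finset.mem_union_right _ (Finset.mem_sdiff.2 ⟨h, hS.2⟩)
      · exact Finset.mem_union_left _ (Finset.mem_sdiff.2 ⟨hS.1, h⟩)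
    have hs' := (card_le_card hs).trans (card_union_le _ _)
    have hs2 : ((((univ : Finset V).powersetCard (k - 2)) \ G).card : ℝ) ≤
      ((((univ : Finset V).powersetCard (k - 2)) \ G0).card : ℝ) + ((G0 \ G).card : ℝ) := by
      exact_mod_cast hs'
    have hp1 : ((((univ : Finset V).powersetCard (k - 2)) \ G0).card : ℝ) ≤
        α * n.choose (k - 2) := by
      refine le_trans ?_ hA1
      rw [Nat.cast_le, ← Set.ncard_coe_finset]
      apply Set.ncard_le_ncard _ (Set.toFinite _)
      intro S hS
      rw [Finset.mem_coe, Finset.mem_sdiff] at hS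
      have hSc := (Finset.mem_powersetCard.1 hS.1).2
      refine ⟨hSc, ?_⟩
      by_contra hc
      exact hS.2 (Finset.mem_filter.2 ⟨hS.1, not_lt.1 hc⟩)
    have hp2 : ((G0 \ G).card : ℝ) ≤ n.choose (k - 3) * (2 * Real.sqrt (2 * (3 * ε * n) * n)) := by
      have hsub : G0 \ G ⊆ ((univ : Finset V).powersetCard (k - 3)).biUnion (fun T =>
          ((univ.filter (fun x => x ∉ T ∧ insert x T ∈ G0)).filter
            (fun x => comp (insert x T) ≠ C T (col (insert x T)))).image (fun x => insert x T)) := by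
        intro S hS
        rw [Finset.mem_sdiff] at hS
        have hSc := hG0c S hS.1
        have : ∃ x ∈ S, comp S ≠ C (S.erase x) (col S) := by
          by_contra hc
          push Not at hc
          exact hS.2 (Finset.mem_filter.2 ⟨hS.1, hc⟩)
        obtain ⟨x, hx, hne⟩ := this
        rw [Finset.mem_biUnion]
        refine ⟨S.erase x, ?_, ?_⟩
        · rw [Finset.mem_powersetCard, card_erase_of_mem hx, hSc]
          exact ⟨subset_univ _, by omega⟩
        · rw [Finset.mem_image]
          refine ⟨x, ?_, insert_erase hx⟩
          rw [Finset.mem_filter, Finset.mem_filter, insert_erase hx]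
          exact ⟨⟨mem_univ _, notMem_erase _ _, hS.1⟩, hne⟩
      have h3 := (card_le_card hsub).trans card_biUnion_le
      have h4 : ((G0 \ G).card : ℝ) ≤ ∑ T ∈ (univ : Finset V).powersetCard (k - 3),
          ((((univ.filter (fun x => x ∉ T ∧ insert x T ∈ G0)).filter
            (fun x => comp (insert x T) ≠ C T (col (insert x T)))).image
              (fun x => insert x T)).card : ℝ) := by exact_mod_cast h3
      refine h4.trans ?_
      have h5 : ∀ T ∈ (univ : Finset V).powersetCard (k - 3),
          ((((univ.filter (fun x => x ∉ T ∧ insert x T ∈ G0)).filter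
            (fun x => comp (insert x T) ≠ C T (col (insert x T)))).image
              (fun x => insert x T)).card : ℝ) ≤ 2 * Real.sqrt (2 * (3 * ε * n) * n) := by
        intro T _
        exact le_trans (by exact_mod_cast card_image_le) (hC T)
      refine (sum_le_sum h5).trans ?_
      rw [sum_const, card_powersetCard, card_univ, nsmul_eq_mul]
    have hsq : Real.sqrt (2 * (3 * ε * n) * n) = Real.sqrt (6 * ε) * n := by
      rw [show 2 * (3 * ε * (n : ℝ)) * n = 6 * ε * (n : ℝ) ^ 2 by ring,
        Real.sqrt_mul (by positivity), Real.sqrt_sq (by positivity)]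
    rw [hsq] at hp2
    have hch : (n.choose (k - 3) : ℝ) * n ≤ 2 * k * n.choose (k - 2) := by
      have h3 := Nat.choose_succ_right_eq n (k - 3)
      rw [show k - 3 + 1 = k - 2 by omega] at h3
      have h4 : n.choose (k - 3) * n ≤ 2 * k * n.choose (k - 2) := by
        calc n.choose (k - 3) * n ≤ n.choose (k - 3) * (2 * (n - (k - 3))) :=
              Nat.mul_le_mul_left _ (by omega)
          _ = 2 * (n.choose (k - 2) * (k - 2)) := by rw [h3]; ring
          _ ≤ 2 * (n.choose (k - 2) * k) := by gcongr; omega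
          _ = _ := by ring
      exact_mod_cast h4
    have h6 : ((G0 \ G).card : ℝ) ≤ α * n.choose (k - 2) := by
      calc ((G0 \ G).card : ℝ) ≤ _ := hp2
        _ = (n.choose (k - 3) * n) * (2 * Real.sqrt (6 * ε)) := by ring
        _ ≤ (2 * k * n.choose (k - 2)) * (2 * Real.sqrt (6 * ε)) := by gcongr
        _ = (4 * k * Real.sqrt (6 * ε)) * n.choose (k - 2) := by ring
        _ ≤ _ := by gcongr
    linarith
  · intro e he
    exact (hprop e (hGG0 he)).1
  · intro e he
    obtain ⟨-, h4, h5, h6⟩ := hprop e (hGG0 he)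
    refine h5.trans ?_
    have hec := hG0c e (hGG0 he)
    rw [degT_one (k - 1) (by omega) _ e (by omega)]
    norm_cast
    apply card_le_card
    intro w hw
    obtain ⟨hwe, hKK⟩ := h6 w hw
    rw [Finset.mem_filter]
    refine ⟨mem_univ _, ?_⟩
    rw [← hKK]
    apply KK_shadow
    · rw [card_insert_of_notMem hwe]; omega
    · rw [hKK]; exact h4
  · intro e he e' he' hcol hint
    have key : ∀ a ∈ G, ∀ T ⊆ a, T.card = k - 3 → comp a = C T (col a) := by
      intro a ha T hT hTc
      have hac := hG0c a (hGG0 ha)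
      obtain ⟨x, hx⟩ := card_eq_one.1 (show (a \ T).card = 1 by
        rw [card_sdiff_of_subset hT]; omega)
      have hxa : x ∈ a \ T := by rw [hx]; exact mem_singleton_self x
      rw [Finset.mem_sdiff] at hxa
      have : a.erase x = T := by
        symm
        apply eq_of_subset_of_card_le
        · intro z hz
          rw [Finset.mem_erase]
          exact ⟨fun h => hxa.2 (h ▸ hz), hT hz⟩
        · rw [card_erase_of_mem hxa.1]; omega
      rw [← this]
      exact (Finset.mem_filter.1 ha).2 x hxa.1
    rw [key e he _ inter_subset_left hint, key e' he' _ inter_subset_right hint, hcol]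

end main

/-- For every `k ≥ 4` there is `α₀ > 0` such that for every `0 < α ≤ α₀` there is `ε₀ > 0`
such that for every `0 < ε ≤ ε₀` there is `n₀` such that for all `n ≥ n₀`: every
2-edge-coloured `(1-ε, α)`-dense `k`-graph `H` on `n` vertices has a `3√ε`-blueprint `G` with
`V(G) = V(H)` which, as a `(k-2)`-graph on `n` vertices, is
`(1 - α^(1/(4(k-2)²+1)), α^(1/(4(k-2)²+1)))`-dense. -/
theorem stmt9 (k : ℕ) (hk : 4 ≤ k) :
    ∃ α₀ : ℝ, 0 < α₀ ∧ ∀ α : ℝ, 0 < α → α ≤ α₀ →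
      ∃ ε₀ : ℝ, 0 < ε₀ ∧ ∀ ε : ℝ, 0 < ε → ε ≤ ε₀ →
        ∃ n₀ : ℕ, ∀ n : ℕ, n₀ ≤ n →
          ∀ (H : Finset (Finset (Fin n))) (cH : Finset (Fin n) → Bool),
            (∀ e ∈ H, e.card = k) → IsDense k H (1 - ε) α →
            ∃ G : Blueprint k H cH (3 * Real.sqrt ε),
              G.verts = Finset.univ ∧
              IsDense (k - 2) G.edges
                (1 - α ^ ((1 : ℝ) / (4 * ((k : ℝ) - 2) ^ 2 + 1)))
                (α ^ ((1 : ℝ) / (4 * ((k : ℝ) - 2) ^ 2 + 1))) := by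
  have hk4 : (4 : ℝ) ≤ k := by exact_mod_cast hk
  set r := k - 2 with hr
  have hr2 : 2 ≤ r := by omega
  have hrk : (k : ℝ) - 2 = r := by rw [hr, Nat.cast_sub (by omega)]; norm_num
  have hr0 : (0 : ℝ) < r := by positivity
  rw [hrk]
  set D : ℝ := (2 ^ (r + 1) * r) ^ r with hD
  have hD0 : 0 < D := by positivity
  set m : ℕ := 4 * r ^ 2 + 1 with hm
  have hm0 : m ≠ 0 := by omega
  have hmc : (4 * (r : ℝ) ^ 2 + 1) = (m : ℝ) := by rw [hm]; push_cast; ring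
  rw [hmc]
  set η₀ : ℝ := min 1 (1 / (3 * D)) with hη₀
  have hη₀0 : 0 < η₀ := lt_min one_pos (by positivity)
  refine ⟨η₀ ^ m, by positivity, ?_⟩
  intro α hα hα0
  set η := α ^ ((1 : ℝ) / (m : ℝ)) with hη
  have hη0 : 0 < η := Real.rpow_pos_of_pos hα _
  have hηm : η ^ m = α := by
    rw [hη, one_div]; exact Real.rpow_inv_natCast_pow hα.le hm0
  have hηle : η ≤ η₀ := by
    rw [← hηm] at hα0
    exact le_of_pow_le_pow_left₀ hm0 hη₀0.le hα0
  have hη1 : η ≤ 1 := hηle.trans (min_le_left _ _)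
  have hηD : η ≤ 1 / (3 * D) := hηle.trans (min_le_right _ _)
  have hβ : 2 * α < (η / (2 ^ (r + 1) * r)) ^ r := by
    rw [div_pow, ← hD, lt_div_iff₀ hD0, ← hηm]
    have h1 : η ^ m ≤ η ^ r * η := by
      rw [← pow_succ]
      apply pow_le_pow_of_le_one hη0.le hη1
      rw [hm]; nlinarith
    have h2 : η * (3 * D) ≤ 1 := by
      rwa [le_div_iff₀ (by positivity)] at hηD
    have h3 : 0 < η ^ r := by positivity
    have h4 : 2 * (η * D) < 1 := by
      have : 0 < η * D := by positivity
      linarith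
    calc 2 * η ^ m * D ≤ 2 * (η ^ r * η) * D := by gcongr
      _ = η ^ r * (2 * (η * D)) := by ring
      _ < η ^ r * 1 := by gcongr
      _ = η ^ r := mul_one _
  refine ⟨min (1 / 10) ((α / (4 * k)) ^ 2 / 6), lt_min (by norm_num) (by positivity), ?_⟩
  intro ε hε hε0
  have hε1 : ε ≤ 1 / 10 := hε0.trans (min_le_left _ _)
  have hε2 : ε ≤ (α / (4 * k)) ^ 2 / 6 := hε0.trans (min_le_right _ _)
  have hαε : 4 * (k : ℝ) * Real.sqrt (6 * ε) ≤ α := by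
    have h1 : Real.sqrt (6 * ε) ≤ α / (4 * k) := by
      apply Real.sqrt_le_iff.2
      exact ⟨by positivity, by linarith⟩
    rw [le_div_iff₀ (by positivity)] at h1
    linarith
  refine ⟨max (2 * k) ⌈2 * (r : ℝ) ^ 2 / η⌉₊, ?_⟩
  intro n hn H cH hu hH
  have hn1 : 2 * k ≤ n := (le_max_left _ _).trans hn
  have hn2 : 2 * (r : ℝ) ^ 2 / η ≤ n :=
    (Nat.le_ceil _).trans (by exact_mod_cast (le_max_right _ _).trans hn)
  obtain ⟨G1, col, comp, hcount, hcomp, hdeg, hagree⟩ :=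
    build k hk ε α hε hε1 (by rw [Fintype.card_fin]; exact hn1) hαε H cH hu hH
  obtain ⟨G, hGG1, hGc, hGd⟩ := cleaning r hr2 η (2 * α) hη0 hη1 hβ
    (by rw [Fintype.card_fin]; exact hn2) G1 hcount
  have hsq : ε ≤ Real.sqrt ε := by
    apply Real.le_sqrt_of_sq_le
    nlinarith
  refine ⟨⟨univ, G, col, comp, hGc, fun e _ => subset_univ _, fun e he => hcomp e (hGG1 he),
    fun e he => le_trans ?_ (hdeg e (hGG1 he)),
    fun e he e' he' => hagree e (hGG1 he) e' (hGG1 he')⟩, rfl, hGd⟩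
  gcongr
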